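/- Let s be a non-empty string and suppose the family S satisfies Eq.(★) for s. Then prelen(s,1) = max{|v| : v is a non-empty palindromic substring of s with 1 ∈ S(v)} and suflen(s,|s|) = max{|v| : v is a non-empty palindromic substring of s with |s| − |v| + 1 ∈ S(v)}; equivalently, the longest palindromic prefix of s is the longest v with 1 ∈ S(v), and the longest palindromic suffix of s is the longest v with |s| − |v| + 1 ∈ S(v). -/

import Mathlib

noncomputable section
open scoped Classical

namespace DEE

variable {α : Type*}

/-- 1-indexed substring `s[i..j]` (empty if `i > j`). -/
def substr (s : List α) (i j : ℕ) : List α := (s.drop (i - 1)).take (j + 1 - i)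

/-- Set of start positions (1-indexed) of occurrences of `t` in `s`. -/
def occ (s t : List α) : Set ℕ :=
  {i | 1 ≤ i ∧ i + t.length - 1 ≤ s.length ∧ (s.drop (i - 1)).take t.length = t}

/-- `v` is a non-empty palindromic substring of `s`. -/
def IsPalSub (s v : List α) : Prop := v ≠ [] ∧ v.Palindrome ∧ v <:+: s

/-- `prelen s i`: length of the longest palindromic prefix of `s[i..|s|]`. -/
def prelen (s : List α) (i : ℕ) : ℕ :=
  sSup {l | 1 ≤ l ∧ l ≤ s.length + 1 - i ∧ (substr s i (i + l - 1)).Palindrome}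

/-- `suflen s i`: length of the longest palindromic suffix of `s[1..i]`. -/
def suflen (s : List α) (i : ℕ) : ℕ :=
  sSup {l | 1 ≤ l ∧ l ≤ i ∧ (substr s (i + 1 - l) i).Palindrome}

/-- longest palindromic prefix of `s[i..|s|]`. -/
def prepal (s : List α) (i : ℕ) : List α := substr s i (i + prelen s i - 1)

/-- longest palindromic suffix of `s[1..i]`. -/
def sufpal (s : List α) (i : ℕ) : List α := substr s (i + 1 - suflen s i) i

/-- The occurrence `s[i..j]` is a surface in `s`. -/
def Surface (s : List α) (i j : ℕ) : Prop :=
  1 ≤ i ∧ i ≤ j ∧ j ≤ s.length ∧ (substr s i j).Palindrome ∧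
    (∀ l, 1 ≤ l → l < i → ¬ (substr s l j).Palindrome) ∧
    (∀ r, j < r → r ≤ s.length → ¬ (substr s i r).Palindrome)

/-- length of the longest proper palindromic suffix of `t`. -/
def linklen (t : List α) : ℕ :=
  sSup {l | l < t.length ∧ (t.drop (t.length - l)).Palindrome}

/-- the longest proper palindromic suffix of `t` (possibly `[]`). -/
def link (t : List α) : List α := t.drop (t.length - linklen t)

/-- `overline-occ`: shifted occurrences `{i + |t| - |link t| : i ∈ occ s t}`. -/
def obar (s t : List α) : Set ℕ := (fun i => i + t.length - (link t).length) '' occ s t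

/-- Eq.(★): the family `S` of reduced occurrence sets represents `occ` for `s`. -/
def SatStar (s : List α) (S : List α → Set ℕ) : Prop :=
  ∀ v, IsPalSub s v →
    occ s v = S v ∪ ⋃ u ∈ {u : List α | IsPalSub s u ∧ link u = v}, (occ s u ∪ obar s u)

/-- number of non-empty palindromic substrings of `s` linking to `v`. -/
def linkcnt (s v : List α) : ℕ := {u | IsPalSub s u ∧ link u = v}.ncard

def precnt (s v : List α) : ℕ := {i | 1 ≤ i ∧ i ≤ s.length ∧ prepal s i = v}.ncard

def sufcnt (s v : List α) : ℕ := {i | 1 ≤ i ∧ i ≤ s.length ∧ sufpal s i = v}.ncard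

def cnt (s v : List α) : ℕ := sufcnt s v

/-- surfaced occurrences of `v` in `s`. -/
def surf (s v : List α) : Set ℕ := {i ∈ occ s v | Surface s i (i + v.length - 1)}

def presurf (s : List α) (i : ℕ) : List α :=
  if Surface s i (i + prelen s i - 1) then prepal s i else []

def sufsurf (s : List α) (i : ℕ) : List α :=
  if Surface s (i + 1 - suflen s i) i then sufpal s i else []

end DEE

namespace DEE

variable {α : Type*}

theorem one_mem_occ {s t : List α} : 1 ∈ occ s t ↔ t <+: s := by
  rw [List.prefix_iff_eq_take]
  constructor
  · rintro ⟨-, -, h⟩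
    simpa using h.symm
  · intro h
    refine ⟨le_rfl, ?_, by simpa using h.symm⟩
    have := congrArg List.length h
    rw [List.length_take] at this
    omega

theorem suffix_of_mem_occ {s t : List α} {i : ℕ} (h : i ∈ occ s t)
    (hi : i + t.length = s.length + 1) : t <:+ s := by
  obtain ⟨h1, -, h⟩ := h
  rw [List.take_of_length_le (by rw [List.length_drop]; omega)] at h
  exact h ▸ List.drop_suffix _ _

theorem mem_occ_of_suffix {s t : List α} (h : t <:+ s) : s.length - t.length + 1 ∈ occ s t := by
  have hl := h.length_le
  refine ⟨by omega, by omega, ?_⟩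
  rw [Nat.add_sub_cancel, ← List.suffix_iff_eq_drop.1 h, List.take_length]

theorem length_link_lt {t : List α} (ht : t ≠ []) : (link t).length < t.length := by
  have hmem : linklen t ∈ {l | l < t.length ∧ (t.drop (t.length - l)).Palindrome} :=
    Nat.sSup_mem ⟨0, List.length_pos_of_ne_nil ht, by simpa using List.Palindrome.nil⟩
      ⟨t.length, fun l hl => hl.1.le⟩
  have := hmem.1
  rw [link, List.length_drop]
  omega

theorem isGreatest_prelen_one {s : List α} (hs : s ≠ []) :
    IsGreatest {n | ∃ v : List α, (v ≠ [] ∧ v.Palindrome ∧ v <+: s) ∧ v.length = n}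
      (prelen s 1) := by
  have hset : {l | 1 ≤ l ∧ l ≤ s.length + 1 - 1 ∧ (substr s 1 (1 + l - 1)).Palindrome} =
      {n | ∃ v : List α, (v ≠ [] ∧ v.Palindrome ∧ v <+: s) ∧ v.length = n} := by
    ext l
    simp only [substr, Set.mem_ofPred_eq, Nat.add_sub_cancel, Nat.sub_self, List.drop_zero,
      Nat.add_sub_cancel_left]
    constructor
    · rintro ⟨h1, h2, h3⟩
      have hl : (s.take l).length = l := by simpa using h2
      exact ⟨s.take l, ⟨List.ne_nil_of_length_pos (by omega), h3, List.take_prefix _ _⟩, hl⟩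
    · rintro ⟨v, ⟨h1, h2, h3⟩, rfl⟩
      exact ⟨List.length_pos_of_ne_nil h1, h3.length_le, List.prefix_iff_eq_take.1 h3 ▸ h2⟩
  have hne : {n | ∃ v : List α, (v ≠ [] ∧ v.Palindrome ∧ v <+: s) ∧ v.length = n}.Nonempty := by
    obtain ⟨a, t, rfl⟩ := List.exists_cons_of_ne_nil hs
    exact ⟨1, [a], ⟨by simp, .singleton a, t, rfl⟩, rfl⟩
  have hbdd : BddAbove {n | ∃ v : List α, (v ≠ [] ∧ v.Palindrome ∧ v <+: s) ∧ v.length = n} := by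
    refine ⟨s.length, ?_⟩
    rintro _ ⟨v, ⟨-, -, h⟩, rfl⟩
    exact h.length_le
  rw [prelen, hset]
  exact ⟨Nat.sSup_mem hne hbdd, fun _ h => le_csSup hbdd h⟩

theorem isGreatest_suflen_length {s : List α} (hs : s ≠ []) :
    IsGreatest {n | ∃ v : List α, (v ≠ [] ∧ v.Palindrome ∧ v <:+ s) ∧ v.length = n}
      (suflen s s.length) := by
  have hset : {l | 1 ≤ l ∧ l ≤ s.length ∧
      (substr s (s.length + 1 - l) s.length).Palindrome} =
      {n | ∃ v : List α, (v ≠ [] ∧ v.Palindrome ∧ v <:+ s) ∧ v.length = n} := by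
    have hsub : ∀ l, 1 ≤ l → l ≤ s.length →
        substr s (s.length + 1 - l) s.length = s.drop (s.length - l) := by
      intro l h1 h2
      rw [substr, List.take_of_length_le (by rw [List.length_drop]; omega)]
      congr 1
      omega
    ext l
    constructor
    · rintro ⟨h1, h2, h3⟩
      rw [hsub l h1 h2] at h3
      have hl : (s.drop (s.length - l)).length = l := by rw [List.length_drop]; omega
      exact ⟨_, ⟨List.ne_nil_of_length_pos (by omega), h3, List.drop_suffix _ _⟩, hl⟩
    · rintro ⟨v, ⟨h1, h2, h3⟩, rfl⟩
      refine ⟨List.length_pos_of_ne_nil h1, h3.length_le, ?_⟩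
      rw [hsub _ (List.length_pos_of_ne_nil h1) h3.length_le, ← List.suffix_iff_eq_drop.1 h3]
      exact h2
  have hne : {n | ∃ v : List α, (v ≠ [] ∧ v.Palindrome ∧ v <:+ s) ∧ v.length = n}.Nonempty :=
    ⟨1, [s.getLast hs], ⟨by simp, .singleton _, s.dropLast, List.dropLast_append_getLast hs⟩, rfl⟩
  have hbdd : BddAbove {n | ∃ v : List α, (v ≠ [] ∧ v.Palindrome ∧ v <:+ s) ∧ v.length = n} := by
    refine ⟨s.length, ?_⟩
    rintro _ ⟨v, ⟨-, -, h⟩, rfl⟩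
    exact h.length_le
  rw [suflen, hset]
  exact ⟨Nat.sSup_mem hne hbdd, fun _ h => le_csSup hbdd h⟩

theorem SatStar.subset_occ {s : List α} {S : List α → Set ℕ} (hS : SatStar s S) {v : List α}
    (hv : IsPalSub s v) : S v ⊆ occ s v :=
  hS v hv ▸ Set.subset_union_left

/-- An occurrence of `v` is in `S v` or comes from an occurrence of a longer palindrome `u`, of
which it is a prefix or a suffix. -/
theorem SatStar.mem_or_exists {s : List α} {S : List α → Set ℕ} (hS : SatStar s S) {v : List α}
    (hv : IsPalSub s v) {i : ℕ} (hi : i ∈ occ s v) :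
    i ∈ S v ∨ ∃ u, IsPalSub s u ∧ v.length < u.length ∧
      (i ∈ occ s u ∨ ∃ j ∈ occ s u, j + u.length = i + v.length) := by
  rw [hS v hv] at hi
  refine hi.imp_right fun h => ?_
  simp only [Set.mem_iUnion, Set.mem_ofPred_eq] at h
  obtain ⟨u, ⟨hu, rfl⟩, h⟩ := h
  have hlt := length_link_lt hu.1
  refine ⟨u, hu, hlt, h.imp_right ?_⟩
  rintro ⟨j, hj, rfl⟩
  exact ⟨j, hj, by dsimp only; omega⟩

end DEE

/-- If `S` satisfies Eq.(★) for a non-empty string `s`, then the length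
of the longest palindromic prefix of `s` is the maximum length of a non-empty palindromic
substring `v` of `s` with `1 ∈ S(v)`, and the length of the longest palindromic suffix of
`s` is the maximum length of a non-empty palindromic substring `v` of `s` with
`|s| - |v| + 1 ∈ S(v)`. -/
theorem prepal_by_prenode {α : Type*} (s : List α) (hs : s ≠ [])
    (S : List α → Set ℕ) (hS : DEE.SatStar s S) :
    DEE.prelen s 1 = sSup {n | ∃ v, DEE.IsPalSub s v ∧ 1 ∈ S v ∧ v.length = n} ∧
      DEE.suflen s s.length =
        sSup {n | ∃ v, DEE.IsPalSub s v ∧ s.length - v.length + 1 ∈ S v ∧ v.length = n} := by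
  constructor
  · obtain ⟨⟨w, ⟨hne, hpal, hw⟩, hlen⟩, hmax⟩ := DEE.isGreatest_prelen_one hs
    refine Eq.symm (IsGreatest.csSup_eq ?_)
    refine ⟨⟨w, ?_⟩, ?_⟩
    · have hsub : DEE.IsPalSub s w := ⟨hne, hpal, hw.isInfix⟩
      refine ⟨hsub, ?_, hlen⟩
      refine (hS.mem_or_exists hsub (DEE.one_mem_occ.2 hw)).resolve_right ?_
      rintro ⟨u, hu, hlt, h | ⟨j, hj, hju⟩⟩
      · have := hmax ⟨u, ⟨hu.1, hu.2.1, DEE.one_mem_occ.1 h⟩, rfl⟩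
        omega
      · have := hj.1
        omega
    · rintro _ ⟨v, hv, h1, rfl⟩
      exact hmax ⟨v, ⟨hv.1, hv.2.1, DEE.one_mem_occ.1 (hS.subset_occ hv h1)⟩, rfl⟩
  · obtain ⟨⟨w, ⟨hne, hpal, hw⟩, hlen⟩, hmax⟩ := DEE.isGreatest_suflen_length hs
    refine Eq.symm (IsGreatest.csSup_eq ?_)
    refine ⟨⟨w, ?_⟩, ?_⟩
    · have hsub : DEE.IsPalSub s w := ⟨hne, hpal, hw.isInfix⟩
      have hle := hw.length_le
      refine ⟨hsub, ?_, hlen⟩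
      refine (hS.mem_or_exists hsub (DEE.mem_occ_of_suffix hw)).resolve_right ?_
      rintro ⟨u, hu, hlt, h | ⟨j, hj, hju⟩⟩
      · have := h.2.1
        omega
      · have := hmax ⟨u, ⟨hu.1, hu.2.1, DEE.suffix_of_mem_occ hj (by omega)⟩, rfl⟩
        omega
    · rintro _ ⟨v, hv, h1, rfl⟩
      have hle := hv.2.2.length_le
      exact hmax
        ⟨v, ⟨hv.1, hv.2.1, DEE.suffix_of_mem_occ (hS.subset_occ hv h1) (by omega)⟩, rfl⟩
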